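/- Hurwitz's theorem: for a real number 0 < u ≤ 1 and positive integer m, the Hurwitz zeta function satisfies ζ(1-m, u) = -B_m(u)/m, where B_m is the m-th Bernoulli polynomial. -/

import Mathlib

open HurwitzZeta

lemma hz_deriv (w : ℂ) {t : ℝ} (ht : 0 < t) :
    HasDerivAt (fun y : ℝ => (y : ℂ) ^ w) (w * (t : ℂ) ^ (w - 1)) t := by
  have h := (hasDerivAt_id (t : ℂ)).cpow_const (c := w) (Or.inl (by simpa using ht))
  simpa using h.comp_ofReal

lemma hz_second_diff (h h' h'' : ℝ → ℂ) (a c M : ℝ) (hac : a ≤ c) (hca : c ≤ a + 1) (hM : 0 ≤ M)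
    (h1 : ∀ t ∈ Set.Icc a (c + 1), HasDerivAt h (h' t) t)
    (h2 : ∀ t ∈ Set.Icc a (c + 1), HasDerivAt h' (h'' t) t)
    (hb : ∀ t ∈ Set.Icc a (c + 1), ‖h'' t‖ ≤ M) :
    ‖h a - h c - ((c : ℂ) - a) * (h c - h (c + 1))‖ ≤ 2 * M := by
  have key : ∀ t ∈ Set.Icc a c, ‖h' t + (h c - h (c + 1))‖ ≤ 2 * M := by
    intro t ht
    have hd : ∀ r ∈ Set.Icc c (c + 1), ‖h' r - h' t‖ ≤ 2 * M := by
      intro r hr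
      have := (convex_Icc a (c + 1)).norm_image_sub_le_of_norm_hasDerivWithin_le
        (fun x hx => (h2 x hx).hasDerivWithinAt) hb (x := t) (y := r)
        ⟨ht.1, by linarith [ht.2]⟩ ⟨by linarith [hr.1], hr.2⟩
      refine this.trans ?_
      have h3 : ‖r - t‖ ≤ 2 := by
        rw [Real.norm_eq_abs, abs_le]
        constructor <;> linarith [hr.1, hr.2, ht.1, ht.2]
      nlinarith
    have := (convex_Icc c (c + 1)).norm_image_sub_le_of_norm_hasDerivWithin_le
      (f := fun r : ℝ => h r - (r : ℂ) * h' t) (f' := fun r => h' r - h' t)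
      (fun x hx => by
        have e := ((hasDerivAt_id (x : ℂ)).comp_ofReal).mul_const (h' t)
        have := (h1 x ⟨by linarith [hx.1], hx.2⟩).sub e
        refine HasDerivAt.hasDerivWithinAt (HasDerivAt.congr_deriv this ?_)
        simp) hd (x := c) (y := c + 1)
      ⟨le_refl _, by linarith⟩ ⟨by linarith, le_refl _⟩
    simp only [add_sub_cancel_left, norm_one, mul_one] at this
    rw [← norm_neg]
    refine le_trans (le_of_eq (congrArg norm ?_)) this
    push_cast
    ring
  have := (convex_Icc a c).norm_image_sub_le_of_norm_hasDerivWithin_le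
      (f := fun r : ℝ => h r - h c - ((c : ℂ) - r) * (h c - h (c + 1)))
      (f' := fun r => h' r + (h c - h (c + 1)))
      (fun x hx => by
        have e := (((hasDerivAt_id (x : ℂ)).comp_ofReal).const_sub (c : ℂ)).mul_const
          (h c - h (c + 1))
        have := ((h1 x ⟨hx.1, by linarith [hx.2]⟩).sub_const (h c)).sub e
        refine HasDerivAt.hasDerivWithinAt (HasDerivAt.congr_deriv this ?_)
        ring) key (x := c) (y := a)
      ⟨hac, le_refl _⟩ ⟨le_refl _, hac⟩
  simp only [sub_self, zero_mul, sub_zero] at this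
  refine this.trans ?_
  have h3 : ‖a - c‖ ≤ 1 := by
    rw [Real.norm_eq_abs, abs_le]
    constructor <;> linarith
  nlinarith

/-- terms of the regularised series -/
noncomputable def hzT (u : ℝ) (n : ℕ) (s : ℂ) : ℂ :=
  ((n + u : ℝ) : ℂ) ^ (-s) - ((n + 1 : ℝ) : ℂ) ^ (-s) -
    (((n + 1 : ℝ) : ℂ) - ((n + u : ℝ) : ℂ)) *
      (((n + 1 : ℝ) : ℂ) ^ (-s) - ((n + 1 + 1 : ℝ) : ℂ) ^ (-s))

lemma hzT_bound (u : ℝ) (hu0 : 0 < u) (hu1 : u ≤ 1) (n : ℕ) (s : ℂ) (hs : -(1 / 2) < s.re)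
    (hs4 : ‖s‖ < 4) : ‖hzT u (n + 1) s‖ ≤ 40 * (1 / ((n + 1 : ℕ) : ℝ) ^ (3 / 2 : ℝ)) := by
  have hn : (0 : ℝ) ≤ n := n.cast_nonneg
  have := hz_second_diff (fun y : ℝ => (y : ℂ) ^ (-s)) (fun y : ℝ => (-s) * (y : ℂ) ^ (-s - 1))
    (fun y : ℝ => (-s) * ((-s - 1) * (y : ℂ) ^ (-s - 1 - 1))) ((n + 1 : ℕ) + u) ((n + 1 : ℕ) + 1)
    (20 * (1 / ((n + 1 : ℕ) : ℝ) ^ (3 / 2 : ℝ))) (by linarith) (by linarith) (by positivity)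
    (fun t ht => hz_deriv _ (by have := ht.1; push_cast at this; linarith))
    (fun t ht => (hz_deriv _ (by have := ht.1; push_cast at this; linarith)).const_mul _)
    (fun t ht => by
      have ht1 : ((n + 1 : ℕ) : ℝ) ≤ t := by linarith [ht.1]
      have hp : (1 : ℝ) ≤ ((n + 1 : ℕ) : ℝ) := by push_cast; linarith
      have ht0 : 0 < t := by linarith
      rw [norm_mul, norm_mul, Complex.norm_cpow_eq_rpow_re_of_pos ht0, ← mul_assoc]
      have e1 : ‖-s‖ ≤ 4 := by rw [norm_neg]; exact hs4.le
      have e2 : ‖-s - 1‖ ≤ 5 := (norm_sub_le _ _).trans (by rw [norm_one]; linarith)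
      have e3 : t ^ (-s - 1 - 1).re ≤ 1 / ((n + 1 : ℕ) : ℝ) ^ (3 / 2 : ℝ) := by
        rw [one_div, ← Real.rpow_neg (by positivity)]
        calc t ^ (-s - 1 - 1).re ≤ t ^ (-(3 / 2) : ℝ) :=
              Real.rpow_le_rpow_of_exponent_le (by linarith) (by simp; linarith)
          _ ≤ _ := Real.rpow_le_rpow_of_nonpos (by linarith) ht1 (by norm_num)
      have e4 : ‖-s‖ * ‖-s - 1‖ ≤ 20 := by
        nlinarith [norm_nonneg (-s), norm_nonneg (-s - 1)]
      exact mul_le_mul e4 e3 (by positivity) (by norm_num))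
  rw [hzT]
  refine le_trans (le_of_eq ?_) (this.trans (by linarith))
  rfl

lemma hzT_diff (u : ℝ) (hu0 : 0 < u) (n : ℕ) : Differentiable ℂ (hzT u n) := by
  have key : ∀ x : ℝ, 0 < x → Differentiable ℂ (fun s : ℂ => (x : ℂ) ^ (-s)) := fun x hx s =>
    differentiableAt_id.neg.const_cpow (Or.inl (by exact_mod_cast hx.ne'))
  have hn : (0 : ℝ) ≤ n := n.cast_nonneg
  exact ((key _ (by linarith)).sub (key _ (by linarith))).sub
    (((key _ (by linarith)).sub (key _ (by linarith))).const_mul _)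

lemma hzT_zero (u : ℝ) (n : ℕ) : hzT u n 0 = 0 := by simp [hzT]

lemma hzT_hasSum (u : ℝ) (hu0 : 0 < u) (hu1 : u ≤ 1) (s : ℂ) (hs : 1 < s.re) :
    HasSum (fun n => hzT u n s)
      (hurwitzZeta (u : UnitAddCircle) s - hurwitzZeta ((1 : ℝ) : UnitAddCircle) s - (1 - u)) := by
  have h1 := hasSum_hurwitzZeta_of_one_lt_re (a := u) ⟨hu0.le, hu1⟩ hs
  have h2 := hasSum_hurwitzZeta_of_one_lt_re (a := 1) ⟨zero_le_one, le_refl _⟩ hs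
  have h3 := (hasSum_nat_add_iff' 1).mpr h2
  have h4 := (h1.sub h2).sub ((h2.sub h3).mul_left (1 - (u : ℂ)))
  have e1 : (fun n => hzT u n s) = fun b : ℕ => 1 / ((b : ℂ) + u) ^ s - 1 / ((b : ℂ) + (1 : ℝ)) ^ s -
      (1 - (u : ℂ)) * (1 / ((b : ℂ) + (1 : ℝ)) ^ s - 1 / (((b + 1 : ℕ) : ℂ) + (1 : ℝ)) ^ s) := by
    ext n
    simp only [hzT, Complex.cpow_neg]
    push_cast
    ring
  rw [e1]
  have e2 : ∑ i ∈ Finset.range 1, 1 / ((i : ℂ) + (1 : ℝ)) ^ s = 1 := by simp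
  rw [e2, sub_sub_cancel, mul_one] at h4
  exact h4

lemma hz_zero (u : ℝ) (hu0 : 0 < u) (hu1 : u ≤ 1) :
    hurwitzZeta (u : UnitAddCircle) 0 = 1 / 2 - u := by
  set U : Set ℂ := {s | -(1 / 2) < s.re} ∩ Metric.ball 0 4 with hU
  have hUo : IsOpen U := (isOpen_lt continuous_const Complex.continuous_re).inter Metric.isOpen_ball
  have hUc : Convex ℝ U := (convex_halfSpace_re_gt _).inter (convex_ball _ _)
  have hsum : Summable (fun n : ℕ => 40 * (1 / ((n + 1 : ℕ) : ℝ) ^ (3 / 2 : ℝ))) :=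
    ((summable_nat_add_iff 1).mpr
      (Real.summable_one_div_nat_rpow.mpr (by norm_num : (1 : ℝ) < 3 / 2))).mul_left 40
  have hG := Complex.differentiableOn_tsum_of_summable_norm hsum
    (F := fun n s => hzT u (n + 1) s)
    (fun n => (hzT_diff u hu0 (n + 1)).differentiableOn) hUo
    (fun n s hs => hzT_bound u hu0 hu1 n s hs.1 (by simpa using hs.2))
  have hG' := ((hzT_diff u hu0 0).differentiableOn (s := U)).add hG
  have hF := ((differentiable_hurwitzZeta_sub_hurwitzZeta (u : UnitAddCircle)
    ((1 : ℝ) : UnitAddCircle)).sub_const (1 - (u : ℂ))).differentiableOn (s := U)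
  have hE := (hF.analyticOnNhd hUo).eqOn_of_preconnected_of_eventuallyEq (hG'.analyticOnNhd hUo)
    hUc.isPreconnected (z₀ := 2) ⟨by norm_num, by norm_num⟩ (by
      filter_upwards [(isOpen_lt continuous_const Complex.continuous_re).mem_nhds
        (show (1 : ℝ) < (2 : ℂ).re by norm_num)] with s hs
      have h := hzT_hasSum u hu0 hu1 s hs
      rw [← h.tsum_eq, h.summable.tsum_eq_zero_add]
      rfl)
  have h0 := hE (show (0 : ℂ) ∈ U from ⟨by norm_num, by norm_num⟩)
  have hz1 : hurwitzZeta ((1 : ℝ) : UnitAddCircle) 0 = -1 / 2 := by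
    rw [AddCircle.coe_period, hurwitzZeta_zero, riemannZeta_zero]
  simp only [Pi.add_apply, hzT_zero, tsum_zero, add_zero, hz1] at h0
  linear_combination h0

/-- Hurwitz's theorem: for a real number `0 < u ≤ 1` and a positive integer `m`, the
Hurwitz zeta function satisfies `ζ(1-m, u) = -B_m(u)/m`, where `B_m` is the `m`-th
Bernoulli polynomial. -/
theorem hurwitzZeta_one_sub_nat (u : ℝ) (hu0 : 0 < u) (hu1 : u ≤ 1) (m : ℕ) (hm : 0 < m) :
    hurwitzZeta (↑u : UnitAddCircle) (1 - m) =
      -((Polynomial.bernoulli m).map (algebraMap ℚ ℂ)).eval (u : ℂ) / m := by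
  obtain ⟨k, rfl⟩ := Nat.exists_eq_succ_of_ne_zero hm.ne'
  rcases eq_or_ne k 0 with rfl | hk
  · have := hz_zero u hu0 hu1
    simp [Polynomial.bernoulli_one, this]
  · have := hurwitzZeta_neg_nat hk (x := u) ⟨hu0.le, hu1⟩
    rw [show (1 : ℂ) - (k.succ : ℕ) = -k by push_cast; ring, this]
    push_cast
    ring
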